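/- Let Λ be a row-finite locally convex k-graph and let g be a function from the set of ∼-classes of ends of Λ to [0,∞). For a vertex v lying on an end, define g(v) := g([x_v]) where x_v is any end on which v lies (this is well-defined, since any two ends through a common vertex are equivalent). Fix a vertex v ∈ Λ⁰ and suppose n₁, n₂ ∈ ℕ^k each have the property that s(λ) lies on an end of Λ for every λ ∈ vΛ^{≤n_i} (i = 1,2). Then Σ_{μ ∈ vΛ^{≤n₁}} g(s(μ)) = Σ_{ν ∈ vΛ^{≤n₂}} g(s(ν)). -/

import Mathlib

open scoped BigOperators ENNReal NNReal

/-- A `k`-graph: a countable small category `Λ` together with a degree functor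
`d : Λ → ℕ^k` satisfying the factorisation property.  Objects are identified with
the identity morphisms, i.e. the paths of degree `0`. -/
structure KGraph (k : ℕ) where
  /-- The morphisms ("paths") of the category. -/
  Path : Type
  countable : Countable Path
  /-- The degree functor. -/
  d : Path → Fin k → ℕ
  /-- The range (codomain) of a path, as an identity morphism. -/
  r : Path → Path
  /-- The source (domain) of a path, as an identity morphism. -/
  s : Path → Path
  /-- Composition `μν` of paths with `s μ = r ν`. -/
  comp : (μ ν : Path) → s μ = r ν → Path
  d_r : ∀ lam : Path, d (r lam) = 0
  d_s : ∀ lam : Path, d (s lam) = 0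
  /-- Paths of degree zero are identity morphisms, identified with their range. -/
  vertex_r : ∀ v : Path, d v = 0 → r v = v
  vertex_s : ∀ v : Path, d v = 0 → s v = v
  r_comp : ∀ (μ ν : Path) (h : s μ = r ν), r (comp μ ν h) = r μ
  s_comp : ∀ (μ ν : Path) (h : s μ = r ν), s (comp μ ν h) = s ν
  d_comp : ∀ (μ ν : Path) (h : s μ = r ν), d (comp μ ν h) = d μ + d ν
  comp_assoc : ∀ (lam μ ν : Path) (h₁ : s lam = r μ) (h₂ : s μ = r ν)
      (h₃ : s (comp lam μ h₁) = r ν) (h₄ : s lam = r (comp μ ν h₂)),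
      comp (comp lam μ h₁) ν h₃ = comp lam (comp μ ν h₂) h₄
  id_comp : ∀ (lam : Path) (h : s (r lam) = r lam), comp (r lam) lam h = lam
  comp_id : ∀ (lam : Path) (h : s lam = r (s lam)), comp lam (s lam) h = lam
  /-- The factorisation property. -/
  factor : ∀ (lam : Path) (m n : Fin k → ℕ), d lam = m + n →
      ∃! p : Path × Path, ∃ h : s p.1 = r p.2,
        d p.1 = m ∧ d p.2 = n ∧ comp p.1 p.2 h = lam

namespace KGraph

variable {k : ℕ} (Λ : KGraph k)

/-- A vertex is a path of degree `0`. -/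
def IsVertex (v : Λ.Path) : Prop := Λ.d v = 0

/-- The set `vΛⁿ` of paths of degree `n` with range `v`. -/
def paths (v : Λ.Path) (n : Fin k → ℕ) : Set Λ.Path :=
  {lam | Λ.d lam = n ∧ Λ.r lam = v}

/-- The set `Λⁿv` of paths of degree `n` with source `v`. -/
def pathsTo (v : Λ.Path) (n : Fin k → ℕ) : Set Λ.Path :=
  {lam | Λ.d lam = n ∧ Λ.s lam = v}

/-- The set `Λ^{≤ n}`. -/
def lePaths (n : Fin k → ℕ) : Set Λ.Path :=
  {lam | Λ.d lam ≤ n ∧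
    ∀ (μ : Λ.Path) (_ : Λ.s lam = Λ.r μ), Λ.d lam + Λ.d μ ≤ n → μ = Λ.s lam}

/-- The set `vΛ^{≤ n}`. -/
def vLePaths (v : Λ.Path) (n : Fin k → ℕ) : Set Λ.Path :=
  {lam | lam ∈ Λ.lePaths n ∧ Λ.r lam = v}

/-- `Λ` is row-finite if each `vΛⁿ` is finite. -/
def RowFinite : Prop := ∀ (v : Λ.Path) (n : Fin k → ℕ), (Λ.paths v n).Finite

/-- `Λ` is locally finite if it is row-finite and each `Λⁿv` is finite. -/
def LocallyFinite : Prop :=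
  Λ.RowFinite ∧ ∀ (v : Λ.Path) (n : Fin k → ℕ), (Λ.pathsTo v n).Finite

/-- `Λ` has no sinks if each `Λⁿv` is nonempty. -/
def NoSinks : Prop :=
  ∀ (v : Λ.Path), Λ.IsVertex v → ∀ n : Fin k → ℕ, (Λ.pathsTo v n).Nonempty

/-- `Λ` has no sources if each `vΛⁿ` is nonempty. -/
def NoSources : Prop :=
  ∀ (v : Λ.Path), Λ.IsVertex v → ∀ n : Fin k → ℕ, (Λ.paths v n).Nonempty

/-- `Λ` is locally convex. -/
def LocallyConvex : Prop :=
  ∀ (i j : Fin k), i ≠ j → ∀ e : Λ.Path, Λ.d e = Pi.single i 1 →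
    Λ.paths (Λ.s e) (Pi.single j 1) = ∅ → Λ.paths (Λ.r e) (Pi.single j 1) = ∅

/-- A `k`-graph trace on `Λ`: a function `g : Λ⁰ → [0,∞)` (extended arbitrarily to
all paths) with `g v = Σ_{λ ∈ vΛ^{≤n}} g (s λ)` for every vertex `v` and `n ∈ ℕ^k`. -/
def IsGraphTrace (g : Λ.Path → ℝ) : Prop :=
  (∀ v : Λ.Path, Λ.IsVertex v → 0 ≤ g v) ∧
  ∀ (v : Λ.Path), Λ.IsVertex v → ∀ (n : Fin k → ℕ) (F : Finset Λ.Path),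
    ↑F = Λ.vLePaths v n → g v = ∑ lam ∈ F, g (Λ.s lam)

/-- Two paths are orthogonal if they have no common extension. -/
def Orthogonal (μ ν : Λ.Path) : Prop :=
  ¬ ∃ (α β : Λ.Path) (h₁ : Λ.s μ = Λ.r α) (h₂ : Λ.s ν = Λ.r β),
      Λ.comp μ α h₁ = Λ.comp ν β h₂

end KGraph

/-- A boundary path of degree `m ∈ (ℕ ∪ {∞})^k` in a `k`-graph `Λ`. -/
structure KGraph.BoundaryPath {k : ℕ} (Λ : KGraph k) where
  /-- The degree of the boundary path. -/
  deg : Fin k → ℕ∞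
  /-- The segment `x(p,q)` for `p ≤ q ≤ deg`. -/
  seg : (Fin k → ℕ) → (Fin k → ℕ) → Λ.Path
  seg_d : ∀ p q : Fin k → ℕ, p ≤ q → (∀ i, (q i : ℕ∞) ≤ deg i) →
    Λ.d (seg p q) = q - p
  seg_r : ∀ p q : Fin k → ℕ, p ≤ q → (∀ i, (q i : ℕ∞) ≤ deg i) →
    Λ.r (seg p q) = seg p p
  seg_s : ∀ p q : Fin k → ℕ, p ≤ q → (∀ i, (q i : ℕ∞) ≤ deg i) →
    Λ.s (seg p q) = seg q q
  seg_comp : ∀ p q t : Fin k → ℕ, p ≤ q → q ≤ t → (∀ i, (t i : ℕ∞) ≤ deg i) →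
    ∀ h : Λ.s (seg p q) = Λ.r (seg q t), Λ.comp (seg p q) (seg q t) h = seg p t
  boundary : ∀ (i : Fin k) (n : Fin k → ℕ), (∀ j, (n j : ℕ∞) ≤ deg j) →
    (n i : ℕ∞) = deg i → Λ.paths (seg n n) (Pi.single i 1) = ∅

namespace KGraph

variable {k : ℕ} (Λ : KGraph k)

/-- An end of `Λ`: a boundary path `x` with `r(x)Λⁿ = {x(0,n)}` for all `n ≤ d(x)`. -/
def IsEnd (x : Λ.BoundaryPath) : Prop :=
  ∀ n : Fin k → ℕ, (∀ i, (n i : ℕ∞) ≤ x.deg i) →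
    Λ.paths (x.seg 0 0) n = {x.seg 0 n}

/-- A vertex `v` lies on the boundary path `x` if `v = x(n)` for some `n ≤ d(x)`. -/
def LiesOn (v : Λ.Path) (x : Λ.BoundaryPath) : Prop :=
  ∃ n : Fin k → ℕ, (∀ i, (n i : ℕ∞) ≤ x.deg i) ∧ v = x.seg n n

/-- Two ends are equivalent if they pass through a common vertex. -/
def EndEquiv (x y : Λ.BoundaryPath) : Prop :=
  ∃ (n m : Fin k → ℕ), (∀ i, (n i : ℕ∞) ≤ x.deg i) ∧ (∀ i, (m i : ℕ∞) ≤ y.deg i) ∧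
    x.seg n n = y.seg m m

end KGraph

/-- A Cuntz–Krieger `Λ`-family in a `C*`-algebra `A`. -/
structure CKFamily {k : ℕ} (Λ : KGraph k) (A : Type*) [NormedRing A] [StarRing A] where
  /-- The partial isometries `s_λ`. -/
  S : Λ.Path → A
  partial_isom : ∀ lam : Λ.Path, S lam * star (S lam) * S lam = S lam
  vertex_star : ∀ v : Λ.Path, Λ.IsVertex v → star (S v) = S v
  vertex_idem : ∀ v : Λ.Path, Λ.IsVertex v → S v * S v = S v
  vertex_orth : ∀ v w : Λ.Path, Λ.IsVertex v → Λ.IsVertex w → v ≠ w → S v * S w = 0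
  comp_mul : ∀ (μ ν : Λ.Path) (h : Λ.s μ = Λ.r ν), S μ * S ν = S (Λ.comp μ ν h)
  star_mul_self : ∀ lam : Λ.Path, star (S lam) * S lam = S (Λ.s lam)
  cuntz_krieger : ∀ (v : Λ.Path), Λ.IsVertex v → ∀ (n : Fin k → ℕ) (F : Finset Λ.Path),
    ↑F = Λ.vLePaths v n → S v = ∑ lam ∈ F, S lam * star (S lam)

/-- A trace on a `C*`-algebra `A`: a map `τ : A⁺ → [0,∞]` (extended arbitrarily to `A`)
which is additive and positively homogeneous on the positive cone and tracial. -/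
structure CstarTrace (A : Type*) [NormedRing A] [StarRing A] [PartialOrder A]
    [Module ℝ A] where
  /-- The underlying map. -/
  τ : A → ℝ≥0∞
  map_add : ∀ a b : A, 0 ≤ a → 0 ≤ b → τ (a + b) = τ a + τ b
  map_smul : ∀ (c : ℝ) (a : A), 0 ≤ c → 0 ≤ a → τ (c • a) = ENNReal.ofReal c * τ a
  tracial : ∀ a : A, τ (star a * a) = τ (a * star a)

namespace KGraph

variable {k : ℕ} {Λ : KGraph k}

theorem exists_comp_eq (lam : Λ.Path) (m n : Fin k → ℕ) (h : Λ.d lam = m + n) :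
    ∃ (μ ν : Λ.Path) (hc : Λ.s μ = Λ.r ν), Λ.d μ = m ∧ Λ.d ν = n ∧ Λ.comp μ ν hc = lam := by
  obtain ⟨⟨μ, ν⟩, ⟨hc, h1, h2, h3⟩, -⟩ := Λ.factor lam m n h
  exact ⟨μ, ν, hc, h1, h2, h3⟩

theorem comp_inj_of_d_eq {μ ν μ' ν' : Λ.Path} (h : Λ.s μ = Λ.r ν) (h' : Λ.s μ' = Λ.r ν')
    (hd : Λ.d μ = Λ.d μ') (he : Λ.comp μ ν h = Λ.comp μ' ν' h') : μ = μ' ∧ ν = ν' := by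
  have hsum : Λ.d μ + Λ.d ν = Λ.d μ' + Λ.d ν' := by
    rw [← Λ.d_comp μ ν h, ← Λ.d_comp μ' ν' h', he]
  have hd' : Λ.d ν' = Λ.d ν := by
    rw [hd] at hsum
    exact (add_left_cancel hsum).symm
  have key := (Λ.factor (Λ.comp μ ν h) (Λ.d μ) (Λ.d ν) (Λ.d_comp μ ν h)).unique
    (y₁ := (μ, ν)) (y₂ := (μ', ν')) ⟨h, rfl, rfl, rfl⟩ ⟨h', hd.symm, hd', he.symm⟩
  exact ⟨congrArg Prod.fst key, congrArg Prod.snd key⟩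

theorem single_le_of_le_apply {i : Fin k} {c : ℕ} {q : Fin k → ℕ} (h : c ≤ q i) :
    Pi.single i c ≤ q := by
  intro j
  by_cases hj : j = i
  · subst hj
    simpa using h
  · simp [hj]

theorem r_eq_s_of_d_eq_zero {μ : Λ.Path} (h : Λ.d μ = 0) : Λ.r μ = Λ.s μ :=
  (Λ.vertex_r μ h).trans (Λ.vertex_s μ h).symm

/-- A path whose degree is positive in direction `i` begins with an edge in direction `i`. -/
theorem paths_single_nonempty {ν : Λ.Path} {i : Fin k} (h : 0 < Λ.d ν i) :
    (Λ.paths (Λ.r ν) (Pi.single i 1)).Nonempty := by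
  have hle : Pi.single i 1 ≤ Λ.d ν := single_le_of_le_apply h
  obtain ⟨e, ν', hc, h1, -, h3⟩ :=
    exists_comp_eq ν (Pi.single i 1) (Λ.d ν - Pi.single i 1) (add_tsub_cancel_of_le hle).symm
  exact ⟨e, h1, by rw [← h3, Λ.r_comp]⟩

theorem d_apply_eq_zero {ν : Λ.Path} {i : Fin k} (h : Λ.paths (Λ.r ν) (Pi.single i 1) = ∅) :
    Λ.d ν i = 0 := by
  by_contra hne
  exact (paths_single_nonempty (Nat.pos_of_ne_zero hne)).ne_empty h

/-- A path belongs to `Λ^{≤ n}` iff its degree is at most `n` and it admits no extension by an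
edge in a direction where the degree is still below `n`. -/
theorem mem_lePaths_iff {lam : Λ.Path} {n : Fin k → ℕ} :
    lam ∈ Λ.lePaths n ↔
      Λ.d lam ≤ n ∧ ∀ i, Λ.d lam i < n i → Λ.paths (Λ.s lam) (Pi.single i 1) = ∅ := by
  constructor
  · rintro ⟨hle, hmax⟩
    refine ⟨hle, fun i hi => Set.eq_empty_iff_forall_notMem.2 ?_⟩
    rintro e ⟨hde, hre⟩
    have he : e = Λ.s lam := by
      refine hmax e hre.symm fun j => ?_
      rw [hde]
      have hj : Λ.d lam j ≤ n j := hle j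
      by_cases hji : j = i
      · subst hji
        simpa using hi
      · simpa [hji] using hj
    have h0 := congrFun hde i
    rw [he, Λ.d_s] at h0
    simp at h0
  · rintro ⟨hle, hmax⟩
    refine ⟨hle, fun μ hμ hd => ?_⟩
    have h0 : Λ.d μ = 0 := by
      funext i
      by_contra hne
      have hi : Λ.d lam i + Λ.d μ i ≤ n i := hd i
      have hpos : 0 < Λ.d μ i := Nat.pos_of_ne_zero hne
      refine hne (d_apply_eq_zero ?_)
      rw [← hμ]
      exact hmax i (by omega)
    rw [hμ, Λ.vertex_r μ h0]

theorem paths_source_eq_empty {ν : Λ.Path} {i : Fin k}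
    (h : Λ.paths (Λ.r ν) (Pi.single i 1) = ∅) : Λ.paths (Λ.s ν) (Pi.single i 1) = ∅ := by
  refine Set.eq_empty_iff_forall_notMem.2 ?_
  rintro e ⟨hde, hre⟩
  have h0 := d_apply_eq_zero (ν := Λ.comp ν e hre.symm) (i := i) (by rwa [Λ.r_comp])
  rw [Λ.d_comp, hde] at h0
  simp at h0

/-- Local convexity propagates from edges to all paths of degree zero in direction `i`. -/
theorem LocallyConvex.paths_range_eq_empty (hlc : Λ.LocallyConvex) {i : Fin k} {ν : Λ.Path}
    (hi : Λ.d ν i = 0) (h : Λ.paths (Λ.s ν) (Pi.single i 1) = ∅) :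
    Λ.paths (Λ.r ν) (Pi.single i 1) = ∅ := by
  induction hN : ∑ j, Λ.d ν j generalizing ν with
  | zero =>
    have h0 : Λ.d ν = 0 := by
      funext j
      exact (Finset.sum_eq_zero_iff.1 hN) j (Finset.mem_univ j)
    rwa [r_eq_s_of_d_eq_zero h0]
  | succ N ih =>
    obtain ⟨j, hj⟩ : ∃ j, Λ.d ν j ≠ 0 := by
      by_contra! hall
      simp [hall] at hN
    have hij : j ≠ i := by
      rintro rfl
      exact hj hi
    have hle : Pi.single j 1 ≤ Λ.d ν := single_le_of_le_apply (Nat.pos_of_ne_zero hj)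
    obtain ⟨e, ν', hc, h1, h2, h3⟩ :=
      exists_comp_eq ν (Pi.single j 1) (Λ.d ν - Pi.single j 1) (add_tsub_cancel_of_le hle).symm
    have hd : Λ.d ν = Pi.single j 1 + Λ.d ν' := by rw [← h3, Λ.d_comp, h1]
    have hrest : Λ.paths (Λ.r ν') (Pi.single i 1) = ∅ := by
      refine ih ?_ ?_ ?_
      · rw [h2, Pi.sub_apply, hi, Nat.zero_sub]
      · rwa [← Λ.s_comp e ν' hc, h3]
      · rw [hd] at hN
        simp only [Pi.add_apply, Finset.sum_add_distrib, Finset.sum_pi_single',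
          Finset.mem_univ, if_true] at hN
        omega
    rw [← h3, Λ.r_comp]
    exact hlc j i hij e h1 (by rwa [hc])

theorem comp_mem_lePaths {μ ν : Λ.Path} {m n : Fin k → ℕ} (hc : Λ.s μ = Λ.r ν)
    (hμ : μ ∈ Λ.lePaths m) (hν : ν ∈ Λ.lePaths n) : Λ.comp μ ν hc ∈ Λ.lePaths (m + n) := by
  rw [mem_lePaths_iff] at hμ hν ⊢
  rw [Λ.d_comp, Λ.s_comp]
  refine ⟨add_le_add hμ.1 hν.1, fun i hi => ?_⟩
  simp only [Pi.add_apply] at hi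
  by_cases hi' : Λ.d μ i < m i
  · exact paths_source_eq_empty (hc ▸ hμ.2 i hi')
  · exact hν.2 i (by omega)

theorem LocallyConvex.exists_comp_eq_of_mem_lePaths (hlc : Λ.LocallyConvex) {lam : Λ.Path}
    {m n : Fin k → ℕ} (h : lam ∈ Λ.lePaths (m + n)) :
    ∃ (μ ν : Λ.Path) (hc : Λ.s μ = Λ.r ν),
      μ ∈ Λ.lePaths m ∧ ν ∈ Λ.lePaths n ∧ Λ.comp μ ν hc = lam := by
  rw [mem_lePaths_iff] at h
  obtain ⟨hle, hmax⟩ := h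
  obtain ⟨μ, ν, hc, h1, h2, h3⟩ := exists_comp_eq lam (Λ.d lam ⊓ m) (Λ.d lam - Λ.d lam ⊓ m)
    (add_tsub_cancel_of_le inf_le_left).symm
  have hs : Λ.s ν = Λ.s lam := by rw [← h3, Λ.s_comp]
  have hμd : ∀ i, Λ.d μ i = min (Λ.d lam i) (m i) := fun i => by rw [h1]; rfl
  have hνd : ∀ i, Λ.d ν i = Λ.d lam i - min (Λ.d lam i) (m i) := fun i => by rw [h2]; rfl
  have hle' : ∀ i, Λ.d lam i ≤ m i + n i := hle
  refine ⟨μ, ν, hc, mem_lePaths_iff.2 ⟨?_, fun i hi => ?_⟩,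
    mem_lePaths_iff.2 ⟨fun i => ?_, fun i hi => ?_⟩, h3⟩
  · rw [h1]
    exact inf_le_right
  · rw [hμd] at hi
    rw [hc]
    refine hlc.paths_range_eq_empty ?_ ?_
    · rw [hνd]
      omega
    · rw [hs]
      exact hmax i (by rw [Pi.add_apply]; omega)
  · have := hle' i
    change Λ.d ν i ≤ n i
    rw [hνd]
    omega
  · rw [hνd] at hi
    rw [hs]
    exact hmax i (by rw [Pi.add_apply]; omega)

theorem d_eq_inf_of_mem_lePaths {μ ν : Λ.Path} {m : Fin k → ℕ} (hc : Λ.s μ = Λ.r ν)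
    (hμ : μ ∈ Λ.lePaths m) : Λ.d μ = Λ.d (Λ.comp μ ν hc) ⊓ m := by
  rw [mem_lePaths_iff] at hμ
  funext i
  have hle : Λ.d μ i ≤ m i := hμ.1 i
  rw [Λ.d_comp, Pi.inf_apply, Pi.add_apply]
  by_cases hi : Λ.d μ i < m i
  · have h0 : Λ.d ν i = 0 := d_apply_eq_zero (by rw [← hc]; exact hμ.2 i hi)
    rw [h0, add_zero, min_eq_left hle]
  · rw [min_eq_right (by omega)]
    omega

theorem comp_inj_of_mem_lePaths {μ ν μ' ν' : Λ.Path} {m : Fin k → ℕ}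
    (hc : Λ.s μ = Λ.r ν) (hc' : Λ.s μ' = Λ.r ν') (hμ : μ ∈ Λ.lePaths m)
    (hμ' : μ' ∈ Λ.lePaths m) (he : Λ.comp μ ν hc = Λ.comp μ' ν' hc') : μ = μ' ∧ ν = ν' := by
  refine comp_inj_of_d_eq hc hc' ?_ he
  rw [d_eq_inf_of_mem_lePaths hc hμ, d_eq_inf_of_mem_lePaths hc' hμ', he]

theorem RowFinite.finite_vLePaths (hrf : Λ.RowFinite) (v : Λ.Path) (n : Fin k → ℕ) :
    (Λ.vLePaths v n).Finite := by
  refine ((Set.finite_Iic n).biUnion fun q _ => hrf v q).subset ?_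
  rintro lam ⟨⟨hle, -⟩, hr⟩
  exact Set.mem_biUnion (show Λ.d lam ∈ Set.Iic n from hle) ⟨rfl, hr⟩

/-- Every path that starts on an end and does not exceed its degree is a segment of the end. -/
theorem IsEnd.eq_seg {x : Λ.BoundaryPath} (hx : Λ.IsEnd x) {p : Fin k → ℕ} {ν : Λ.Path}
    (hr : Λ.r ν = x.seg p p) (hq : ∀ i, ((p + Λ.d ν) i : ℕ∞) ≤ x.deg i) :
    ν = x.seg p (p + Λ.d ν) := by
  have hle : p ≤ p + Λ.d ν := le_self_add
  have hp : ∀ i, (p i : ℕ∞) ≤ x.deg i := fun i =>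
    (Nat.cast_le.2 (hle i)).trans (hq i)
  have h0 : (0 : Fin k → ℕ) ≤ p := zero_le
  have hc : Λ.s (x.seg 0 p) = Λ.r ν := by rw [x.seg_s 0 p h0 hp, hr]
  have hc' : Λ.s (x.seg 0 p) = Λ.r (x.seg p (p + Λ.d ν)) := by
    rw [x.seg_s 0 p h0 hp, x.seg_r p _ hle hq]
  have hmem : Λ.comp (x.seg 0 p) ν hc ∈ Λ.paths (x.seg 0 0) (p + Λ.d ν) :=
    ⟨by rw [Λ.d_comp, x.seg_d 0 p h0 hp, tsub_zero], by rw [Λ.r_comp, x.seg_r 0 p h0 hp]⟩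
  rw [hx _ hq, Set.mem_singleton_iff, ← x.seg_comp 0 p _ h0 hle hq hc'] at hmem
  exact (comp_inj_of_d_eq hc hc' rfl hmem).2

/-- A path that starts on an end does not exceed the degree of the end. -/
theorem IsEnd.add_d_le {x : Λ.BoundaryPath} (hx : Λ.IsEnd x) {p : Fin k → ℕ}
    (hp : ∀ i, (p i : ℕ∞) ≤ x.deg i) {ν : Λ.Path} (hr : Λ.r ν = x.seg p p) (i : Fin k) :
    ((p + Λ.d ν) i : ℕ∞) ≤ x.deg i := by
  by_contra! hlt
  obtain ⟨D, hD⟩ := ENat.ne_top_iff_exists.1 hlt.ne_top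
  have hpD : p i ≤ D := by
    have := hp i
    rw [← hD] at this
    exact_mod_cast this
  have hDν : D < p i + Λ.d ν i := by
    rw [← hD] at hlt
    exact_mod_cast hlt
  have hle : Pi.single i (D - p i) ≤ Λ.d ν := single_le_of_le_apply (by omega)
  obtain ⟨β, γ, hc, h1, h2, h3⟩ := exists_comp_eq ν (Pi.single i (D - p i))
    (Λ.d ν - Pi.single i (D - p i)) (add_tsub_cancel_of_le hle).symm
  have hi : (p + Λ.d β) i = D := by
    rw [h1, Pi.add_apply, Pi.single_eq_same]
    omega
  have hq : ∀ j, ((p + Λ.d β) j : ℕ∞) ≤ x.deg j := fun j => by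
    by_cases hj : j = i
    · subst hj
      rw [hi, hD]
    · rw [h1, Pi.add_apply, Pi.single_eq_of_ne hj, add_zero]
      exact hp j
  have hβ := hx.eq_seg (ν := β) (by rw [← hr, ← h3, Λ.r_comp]) hq
  have hs : Λ.s β = x.seg (p + Λ.d β) (p + Λ.d β) := by
    conv_lhs => rw [hβ]
    exact x.seg_s _ _ le_self_add hq
  have hγ := d_apply_eq_zero (ν := γ) (i := i)
    (by rw [← hc, hs]; exact x.boundary i _ hq (by rw [hi, hD]))
  rw [h2, Pi.sub_apply, Pi.single_eq_same] at hγ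
  omega

/-- The degree of a path of `wΛ^{≤ n}` with `w = x(p)` on an end `x` is `n ∧ (d(x) - p)`. -/
theorem IsEnd.cast_d_eq_min {x : Λ.BoundaryPath} (hx : Λ.IsEnd x) {p n : Fin k → ℕ}
    (hp : ∀ i, (p i : ℕ∞) ≤ x.deg i) {ν : Λ.Path} (hν : ν ∈ Λ.vLePaths (x.seg p p) n)
    (i : Fin k) : (Λ.d ν i : ℕ∞) = min (n i : ℕ∞) (x.deg i - p i) := by
  have hq := hx.add_d_le hp hν.2
  have hs : Λ.s ν = x.seg (p + Λ.d ν) (p + Λ.d ν) := by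
    conv_lhs => rw [hx.eq_seg hν.2 hq]
    exact x.seg_s _ _ le_self_add hq
  obtain ⟨hle, hmax⟩ := mem_lePaths_iff.1 hν.1
  have hlei : Λ.d ν i ≤ n i := hle i
  have hqi := hq i
  rw [Pi.add_apply, Nat.cast_add] at hqi
  refine le_antisymm (le_min (Nat.cast_le.2 hlei)
    (ENat.le_sub_of_add_le_left (ENat.natCast_ne_top _) hqi)) ?_
  by_cases hi : Λ.d ν i < n i
  · refine (min_le_right _ _).trans (tsub_le_iff_left.2 ?_)
    by_contra! hlt
    have hq' : ∀ j, ((p + Λ.d ν + Pi.single i 1 : Fin k → ℕ) j : ℕ∞) ≤ x.deg j := fun j => by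
      by_cases hj : j = i
      · subst hj
        simpa using Order.add_one_le_of_lt hlt
      · simpa [hj] using hq j
    have hmem : x.seg (p + Λ.d ν) (p + Λ.d ν + Pi.single i 1) ∈
        Λ.paths (Λ.s ν) (Pi.single i 1) :=
      ⟨by rw [x.seg_d _ _ le_self_add hq', add_tsub_cancel_left],
        by rw [x.seg_r _ _ le_self_add hq', hs]⟩
    rw [hmax i hi] at hmem
    exact hmem
  · exact (min_le_left _ _).trans (Nat.cast_le.2 (not_lt.1 hi))

/-- For a vertex `w` on an end `x`, the set `wΛ^{≤ n}` consists of a single path, whose source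
also lies on `x`. -/
theorem IsEnd.existsUnique_mem_vLePaths {x : Λ.BoundaryPath} (hx : Λ.IsEnd x) {w : Λ.Path}
    (hw : Λ.LiesOn w x) (n : Fin k → ℕ) :
    ∃ ν ∈ Λ.vLePaths w n, Λ.LiesOn (Λ.s ν) x ∧ ∀ ν' ∈ Λ.vLePaths w n, ν' = ν := by
  obtain ⟨p, hp, rfl⟩ := hw
  have hfin : ∀ i, ∃ t : ℕ, (t : ℕ∞) = min (n i : ℕ∞) (x.deg i - p i) := fun i =>
    ENat.ne_top_iff_exists.1 (ne_top_of_le_ne_top (ENat.natCast_ne_top (n i)) (min_le_left _ _))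
  choose t ht using hfin
  have hq : ∀ i, ((p + t) i : ℕ∞) ≤ x.deg i := fun i => by
    rw [Pi.add_apply, Nat.cast_add, ht]
    calc (p i : ℕ∞) + min (n i : ℕ∞) (x.deg i - p i)
        ≤ p i + (x.deg i - p i) := by gcongr; exact min_le_right _ _
      _ = x.deg i := add_tsub_cancel_of_le (hp i)
  have hle : p ≤ p + t := le_self_add
  have hd : Λ.d (x.seg p (p + t)) = t := by rw [x.seg_d _ _ hle hq, add_tsub_cancel_left]
  refine ⟨x.seg p (p + t), ⟨mem_lePaths_iff.2 ⟨fun i => ?_, fun i hi => ?_⟩,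
    x.seg_r _ _ hle hq⟩, ⟨p + t, hq, x.seg_s _ _ hle hq⟩, fun ν' hν' => ?_⟩
  · rw [hd, ← Nat.cast_le (α := ℕ∞), ht]
    exact min_le_left _ _
  · rw [hd] at hi
    rw [x.seg_s _ _ hle hq]
    refine x.boundary i _ hq (le_antisymm (hq i) ?_)
    rw [Pi.add_apply, Nat.cast_add, ← tsub_le_iff_left, ht]
    have hlt : min (n i : ℕ∞) (x.deg i - p i) < n i := by
      rw [← ht]
      exact_mod_cast hi
    exact le_min ((min_lt_iff.1 hlt).resolve_left (lt_irrefl _)).le le_rfl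
  · have hdν : Λ.d ν' = t := by
      funext i
      have := hx.cast_d_eq_min hp hν' i
      rw [← ht] at this
      exact_mod_cast this
    have := hx.eq_seg hν'.2 (by rwa [hdν])
    rwa [hdν] at this

/-- If every path of `vΛ^{≤ n}` has its source on an end, then enlarging the exponent does not
change the sum over `vΛ^{≤ n}` of a vertex function that is constant along ends. -/
theorem LocallyConvex.sum_vLePaths_add {M : Type*} [AddCommMonoid M] (hlc : Λ.LocallyConvex)
    {g : Λ.Path → M}
    (hg : ∀ x : Λ.BoundaryPath, Λ.IsEnd x → ∀ w w' : Λ.Path,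
      Λ.LiesOn w x → Λ.LiesOn w' x → g w = g w')
    {v : Λ.Path} {n m : Fin k → ℕ}
    (hend : ∀ lam ∈ Λ.vLePaths v n, ∃ x : Λ.BoundaryPath, Λ.IsEnd x ∧ Λ.LiesOn (Λ.s lam) x)
    {F G : Finset Λ.Path} (hF : ↑F = Λ.vLePaths v n) (hG : ↑G = Λ.vLePaths v (n + m)) :
    ∑ μ ∈ F, g (Λ.s μ) = ∑ lam ∈ G, g (Λ.s lam) := by
  have hFm : ∀ μ, μ ∈ F ↔ μ ∈ Λ.vLePaths v n := fun μ => by rw [← hF, Finset.mem_coe]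
  have hGm : ∀ μ, μ ∈ G ↔ μ ∈ Λ.vLePaths v (n + m) := fun μ => by rw [← hG, Finset.mem_coe]
  have hex : ∀ μ ∈ F, ∃ ν ∈ Λ.vLePaths (Λ.s μ) m, g (Λ.s μ) = g (Λ.s ν) ∧
      ∀ ν' ∈ Λ.vLePaths (Λ.s μ) m, ν' = ν := fun μ hμ => by
    obtain ⟨x, hx, hon⟩ := hend μ ((hFm μ).1 hμ)
    obtain ⟨ν, hν, hνx, huniq⟩ := hx.existsUnique_mem_vLePaths hon m
    exact ⟨ν, hν, hg x hx _ _ hon hνx, huniq⟩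
  choose f hf hfg huniq using hex
  refine Finset.sum_bij (fun μ hμ => Λ.comp μ (f μ hμ) (hf μ hμ).2.symm) ?_ ?_ ?_ ?_
  · intro μ hμ
    have hμ' := (hFm μ).1 hμ
    exact (hGm _).2 ⟨comp_mem_lePaths _ hμ'.1 (hf μ hμ).1, by rw [Λ.r_comp, hμ'.2]⟩
  · intro μ hμ μ' hμ' he
    exact (comp_inj_of_mem_lePaths _ _ ((hFm μ).1 hμ).1 ((hFm μ').1 hμ').1 he).1
  · intro lam hlam
    obtain ⟨hle, hr⟩ := (hGm lam).1 hlam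
    obtain ⟨μ, ν, hc, hμ, hν, rfl⟩ := hlc.exists_comp_eq_of_mem_lePaths hle
    have hμF : μ ∈ F := (hFm μ).2 ⟨hμ, by rw [← hr, Λ.r_comp]⟩
    obtain rfl := huniq μ hμF ν ⟨hν, hc.symm⟩
    exact ⟨μ, hμF, rfl⟩
  · intro μ hμ
    rw [Λ.s_comp]
    exact hfg μ hμ

end KGraph

/-- If every path in `vΛ^{≤n₁}` and `vΛ^{≤n₂}` ends on an end of `Λ`, then the two
sums of the induced end-class values agree. -/
theorem sum_independent_of_exponent
    {k : ℕ} (Λ : KGraph k) (hrf : Λ.RowFinite) (hlc : Λ.LocallyConvex)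
    (gE : Λ.BoundaryPath → ℝ)
    (hnonneg : ∀ x : Λ.BoundaryPath, Λ.IsEnd x → 0 ≤ gE x)
    (hconst : ∀ x y : Λ.BoundaryPath, Λ.IsEnd x → Λ.IsEnd y → Λ.EndEquiv x y → gE x = gE y)
    (gv : Λ.Path → ℝ)
    (hgv : ∀ x : Λ.BoundaryPath, Λ.IsEnd x → ∀ n : Fin k → ℕ,
      (∀ i, (n i : ℕ∞) ≤ x.deg i) → gv (x.seg n n) = gE x)
    (v : Λ.Path) (hv : Λ.IsVertex v) (n₁ n₂ : Fin k → ℕ)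
    (h₁ : ∀ lam ∈ Λ.vLePaths v n₁, ∃ x : Λ.BoundaryPath, Λ.IsEnd x ∧ Λ.LiesOn (Λ.s lam) x)
    (h₂ : ∀ lam ∈ Λ.vLePaths v n₂, ∃ x : Λ.BoundaryPath, Λ.IsEnd x ∧ Λ.LiesOn (Λ.s lam) x)
    (F₁ F₂ : Finset Λ.Path) (hF₁ : ↑F₁ = Λ.vLePaths v n₁) (hF₂ : ↑F₂ = Λ.vLePaths v n₂) :
    ∑ μ ∈ F₁, gv (Λ.s μ) = ∑ ν ∈ F₂, gv (Λ.s ν) := by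
  have hg : ∀ x : Λ.BoundaryPath, Λ.IsEnd x → ∀ w w' : Λ.Path,
      Λ.LiesOn w x → Λ.LiesOn w' x → gv w = gv w' := by
    rintro x hx _ _ ⟨p, hp, rfl⟩ ⟨q, hq, rfl⟩
    rw [hgv x hx p hp, hgv x hx q hq]
  have hG := (hrf.finite_vLePaths v (n₁ + n₂)).coe_toFinset
  rw [hlc.sum_vLePaths_add hg h₁ hF₁ hG,
    hlc.sum_vLePaths_add hg h₂ hF₂ (hG.trans (by rw [add_comm]))]
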